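/- Let M ∈ F_2^{m×n}, b ∈ F_2^m, let G = G(M,b), and let u be a magic unitary over a unital C*-algebra indexed by V(G) satisfying the Qut(G) relations. For each i ∈ [n] belonging to some S_k, let y_i = Σ_{β ∈ ±1^{S_k}_{b_k}} α_i β_i · u_{(k,α),(k,β)} (for any such k and any α ∈ ±1^{S_k}_{b_k}). Then for every k ∈ [m] and all α,β ∈ ±1^{S_k}_{b_k}, ∏_{i∈S_k} (1 + α_iβ_i y_i)/2 = u_{(k,α),(k,β)} (product in increasing order of indices; the factors commute). -/

import Mathlib

open scoped BigOperators

/-- A magic unitary over a ring with star: every entry is a projection and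
every row and column sums to `1`. -/
def IsMagicUnitary {I J A : Type*} [Fintype I] [Fintype J] [Ring A] [StarRing A]
    (u : I → J → A) : Prop :=
  (∀ i j, star (u i j) = u i j) ∧ (∀ i j, u i j * u i j = u i j) ∧
    (∀ i, ∑ j, u i j = 1) ∧ (∀ j, ∑ i, u i j = 1)

/-- The sign `(-1)^x` for `x ∈ F₂`. -/
def signZ (x : ZMod 2) : ℤˣ := if x = 0 then 1 else -1

/-- `S_k = {i : M k i = 1}`. -/
def Sk {m n : ℕ} (M : Matrix (Fin m) (Fin n) (ZMod 2)) (k : Fin m) : Finset (Fin n) :=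
  Finset.univ.filter fun i => M k i = 1

/-- The vertex set of the colored graph `G(M,b)`: pairs `(k, α)` where
`α : ±1^{S_k}` with `∏_{i ∈ S_k} α i = (-1)^{b k}`, encoded as functions on `Fin n`
normalized to `1` off `S_k`. -/
abbrev GVertex {m n : ℕ} (M : Matrix (Fin m) (Fin n) (ZMod 2)) (b : Fin m → ZMod 2) : Type :=
  {p : Fin m × (Fin n → ℤˣ) //
    (∀ i, i ∉ Sk M p.1 → p.2 i = 1) ∧ ∏ i ∈ Sk M p.1, p.2 i = signZ (b p.1)}

/-- `v` and `w` are joined by an edge of color `({l,k}, δ|_{S_l ∩ S_k})` in `G(M,b)`. -/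
def adjC {m n : ℕ} (M : Matrix (Fin m) (Fin n) (ZMod 2)) (b : Fin m → ZMod 2)
    (l k : Fin m) (δ : Fin n → ℤˣ) (v w : GVertex M b) : Prop :=
  ((v.1.1 = l ∧ w.1.1 = k) ∨ (v.1.1 = k ∧ w.1.1 = l)) ∧ v ≠ w ∧
    (Sk M l ∩ Sk M k).Nonempty ∧
    ∀ i ∈ Sk M l ∩ Sk M k, v.1.2 i * w.1.2 i = δ i

open Classical in
/-- The 0/1 adjacency matrix (with entries in `A`) of the color class
`({l,k}, δ|_{S_l ∩ S_k})` of the colored graph `G(M,b)`. -/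
noncomputable def adjMat (A : Type*) [Zero A] [One A] {m n : ℕ}
    (M : Matrix (Fin m) (Fin n) (ZMod 2)) (b : Fin m → ZMod 2)
    (l k : Fin m) (δ : Fin n → ℤˣ) (v w : GVertex M b) : A :=
  if adjC M b l k δ v w then 1 else 0

/-- `u` satisfies the `Qut(G(M,b))` relations: entries vanish between distinct
vertex colors, and `u` commutes with every edge-color adjacency matrix. -/
def QutRel (A : Type*) [Ring A] {m n : ℕ} (M : Matrix (Fin m) (Fin n) (ZMod 2))
    (b : Fin m → ZMod 2) (u : GVertex M b → GVertex M b → A) : Prop :=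
  (∀ v w : GVertex M b, v.1.1 ≠ w.1.1 → u v w = 0) ∧
  ∀ (l k : Fin m) (δ : Fin n → ℤˣ) (v w : GVertex M b),
    ∑ x, adjMat A M b l k δ v x * u x w = ∑ x, u v x * adjMat A M b l k δ x w

/-- The element `y_i = ∑_{β ∈ ±1^{S_k}_{b_k}} α_i β_i · u_{(k,α),(k,β)}`, computed from the
representative vertex `v = (k, α)` (by the block-structure lemma it does not depend on
the choice of representative with `i ∈ S_k`). -/
def yRep {m n : ℕ} {M : Matrix (Fin m) (Fin n) (ZMod 2)} {b : Fin m → ZMod 2}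
    {A : Type*} [Ring A] (u : GVertex M b → GVertex M b → A)
    (v : GVertex M b) (i : Fin n) : A :=
  ∑ w ∈ Finset.univ.filter (fun w : GVertex M b => w.1.1 = v.1.1),
    ((v.1.2 i * w.1.2 i : ℤˣ) : ℤ) • u v w

open Finset Filter Topology

section Projections

variable {A : Type*} [NormedRing A] [StarRing A] [CStarRing A]

/-- A self-adjoint element of a C⋆-ring with bounded powers is a contraction. -/
lemma IsSelfAdjoint.norm_le_one_of_norm_pow_le {z : A} (hz : IsSelfAdjoint z) (C : ℝ)
    (hC : ∀ k : ℕ, ‖z ^ (k + 1)‖ ≤ C) : ‖z‖ ≤ 1 := by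
  by_contra! hlt
  obtain ⟨k, hk⟩ := pow_unbounded_of_one_lt C hlt
  have h1 : ‖z ^ 2 ^ k‖ = ‖z‖ ^ 2 ^ k := congrArg NNReal.toReal (hz.nnnorm_pow_two_pow k)
  have h2 : ‖z‖ ^ k ≤ ‖z‖ ^ 2 ^ k := pow_le_pow_right₀ hlt.le Nat.lt_two_pow_self.le
  have h3 := hC (2 ^ k - 1)
  rw [Nat.sub_add_cancel Nat.one_le_two_pow] at h3
  linarith

lemma IsStarProjection.norm_one_sub_conj_le_one {p q : A} (hp : IsStarProjection p)
    (hq : IsStarProjection q) : ‖1 - p * q * p‖ ≤ 1 := by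
  have hpp : p * p = p := hp.isIdempotentElem.eq
  set c : A := p * (1 - q) * p with hc
  have hz : 1 - p * q * p = (1 - p) + c := by
    rw [hc, mul_sub, sub_mul, mul_one, hpp]; abel
  have hec : (1 - p) * c = 0 := by
    rw [hc, ← mul_assoc, ← mul_assoc, sub_mul, one_mul, hpp, sub_self, zero_mul, zero_mul]
  have hce : c * (1 - p) = 0 := by
    rw [hc, mul_assoc, mul_sub p 1 p, mul_one, hpp, sub_self, mul_zero]
  have hn : ‖c‖ ≤ 1 := by
    have h1 := norm_mul_le (p * (1 - q)) p
    have h2 := norm_mul_le p (1 - q)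
    have h3 := hp.norm_le
    have h4 := hq.one_sub.norm_le
    have h5 := mul_le_one₀ h3 (norm_nonneg _) h4
    have h6 := mul_le_one₀ (h2.trans h5) (norm_nonneg _) h3
    exact h1.trans h6
  have hee : (1 - p) * (1 - p) = 1 - p := hp.one_sub.isIdempotentElem.eq
  have hpow : ∀ k : ℕ, ((1 - p) + c) ^ (k + 1) = (1 - p) + c ^ (k + 1) := by
    intro k
    induction k with
    | zero => simp
    | succ k ih =>
      have : c ^ (k + 1) * (1 - p) = 0 := by rw [pow_succ, mul_assoc, hce, mul_zero]
      rw [pow_succ, ih, add_mul, mul_add, mul_add, hee, hec, this, ← pow_succ]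
      simp
  have hsa : IsSelfAdjoint ((1 - p) + c) := by
    rw [← hz, isSelfAdjoint_iff, star_sub, star_one, star_mul, star_mul,
      hp.isSelfAdjoint.star_eq, hq.isSelfAdjoint.star_eq, mul_assoc]
  rw [hz]
  refine hsa.norm_le_one_of_norm_pow_le 2 fun k => ?_
  rw [hpow]
  have h1 := norm_add_le (1 - p) (c ^ (k + 1))
  have h2 : ‖1 - p‖ ≤ 1 := hp.one_sub.norm_le
  have h3 : ‖c ^ (k + 1)‖ ≤ 1 :=
    (norm_pow_le' c k.succ_pos).trans (pow_le_one₀ (norm_nonneg c) hn)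
  exact h1.trans ((add_le_add h2 h3).trans_eq one_add_one_eq_two)

variable [NormedAlgebra ℂ A] [CompleteSpace A]

/-- A self-adjoint element `y` with `‖1 - y‖ ≤ 1` and `‖r + y‖ ≤ r` vanishes. -/
lemma IsSelfAdjoint.eq_zero_of_norm_le {y : A} (hy : IsSelfAdjoint y) (r : ℕ)
    (h1 : ‖1 - y‖ ≤ 1) (h2 : ‖(r : A) + y‖ ≤ r) : y = 0 := by
  nontriviality A
  have hspec : ∀ z ∈ spectrum ℂ y, z = 0 := by
    intro z hz
    have e1 : ‖1 - z‖ ≤ 1 := by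
      refine (spectrum.norm_le_norm_of_mem (a := 1 - y) ?_).trans h1
      have h : (1 : ℂ) - z ∈ spectrum ℂ (algebraMap ℂ A 1 - y) := by
        rw [← spectrum.singleton_sub_eq]
        exact Set.sub_mem_sub rfl hz
      simpa using h
    have e2 : ‖(r : ℂ) + z‖ ≤ r := by
      refine (spectrum.norm_le_norm_of_mem (a := (r : A) + y) ?_).trans h2
      have h : (r : ℂ) + z ∈ spectrum ℂ (algebraMap ℂ A r + y) := by
        rw [← spectrum.singleton_add_eq]
        exact Set.add_mem_add rfl hz
      simpa using h
    have f1 := pow_le_one₀ (n := 2) (norm_nonneg _) e1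
    have f2 := pow_le_pow_left₀ (norm_nonneg _) e2 2
    rw [Complex.sq_norm, Complex.normSq_apply] at f1 f2
    simp only [Complex.sub_re, Complex.sub_im, Complex.add_re, Complex.add_im, Complex.one_re,
      Complex.one_im, Complex.natCast_re, Complex.natCast_im, zero_sub, zero_add] at f1 f2
    have hr : (0 : ℝ) ≤ r := r.cast_nonneg
    have g1 : z.re * z.re + z.im * z.im ≤ 2 * z.re := by linarith
    have g2 := mul_le_mul_of_nonneg_left g1 hr
    have g3 : z.re * z.re + z.im * z.im ≤ 0 := by
      nlinarith [mul_nonneg hr (add_nonneg (mul_self_nonneg z.re) (mul_self_nonneg z.im))]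
    apply Complex.normSq_eq_zero.mp
    rw [Complex.normSq_apply]
    exact le_antisymm g3 (add_nonneg (mul_self_nonneg _) (mul_self_nonneg _))
  have hrad : spectralRadius ℂ y = 0 := by
    rw [spectralRadius]
    simp only [ENNReal.iSup_eq_zero]
    intro z hz
    simp [hspec z hz]
  have hlim : Tendsto (fun _ : ℕ => (‖y‖₊ : ENNReal)) atTop (𝓝 0) := by
    have h := (spectrum.pow_nnnorm_pow_one_div_tendsto_nhds_spectralRadius y).comp
      (tendsto_pow_atTop_atTop_of_one_lt one_lt_two)
    rw [hrad] at h
    refine h.congr fun k => ?_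
    rw [Function.comp_apply, hy.nnnorm_pow_two_pow, ENNReal.coe_pow, ← ENNReal.rpow_natCast,
      ← ENNReal.rpow_mul]
    simp
  simpa using tendsto_nhds_unique tendsto_const_nhds hlim

/-- Projections summing to `1` in a C⋆-algebra are pairwise orthogonal. -/
lemma IsStarProjection.mul_eq_zero_of_sum_eq_one {ι : Type*} [Fintype ι] {p : ι → A}
    (hp : ∀ i, IsStarProjection (p i)) (hsum : ∑ i, p i = 1) {a c : ι} (hac : a ≠ c) :
    p c * p a = 0 := by
  classical
  have hpa : p a * p a = p a := (hp a).isIdempotentElem.eq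
  set y : ι → A := fun i => p a * p i * p a with hy
  have hsumy : ∑ i, y i = p a := by
    rw [hy, ← Finset.sum_mul, ← Finset.mul_sum, hsum, mul_one, hpa]
  have hya : y a = p a := by simp only [hy, hpa]
  have hc : c ∈ univ.erase a := mem_erase.2 ⟨hac.symm, mem_univ c⟩
  set B := (univ.erase a).erase c with hB
  have hyB : y c + ∑ i ∈ B, y i = 0 := by
    rw [hB, Finset.add_sum_erase _ _ hc]
    have := Finset.add_sum_erase univ y (mem_univ a)
    rw [hsumy, hya] at this
    exact add_eq_left.mp this
  have hnorm : ∀ i, ‖1 - y i‖ ≤ 1 := fun i => (hp a).norm_one_sub_conj_le_one (hp i)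
  have hsum_eq : ((#B : ℕ) : A) + y c = ∑ i ∈ B, (1 - y i) := by
    rw [Finset.sum_sub_distrib, eq_neg_of_add_eq_zero_left hyB]
    simp [sub_eq_add_neg]
  have hyc : IsSelfAdjoint (y c) := by
    simp only [hy]
    rw [isSelfAdjoint_iff, star_mul, star_mul, (hp a).isSelfAdjoint.star_eq,
      (hp c).isSelfAdjoint.star_eq, mul_assoc]
  have h0 : y c = 0 := by
    refine hyc.eq_zero_of_norm_le #B (hnorm c) ?_
    rw [hsum_eq]
    refine (norm_sum_le_of_le B fun i _ => hnorm i).trans ?_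
    simp
  have hstar : star (p c * p a) * (p c * p a) = y c := by
    rw [star_mul, (hp a).isSelfAdjoint.star_eq, (hp c).isSelfAdjoint.star_eq, mul_assoc,
      ← mul_assoc (p c), (hp c).isIdempotentElem.eq, ← mul_assoc]
  rw [h0] at hstar
  exact CStarRing.star_mul_self_eq_zero_iff _ |>.mp hstar

end Projections

lemma sum_mul_sum_of_orthogonal {ι R : Type*} [DecidableEq ι] [Ring R] {p : ι → R}
    (hidem : ∀ i, p i * p i = p i) (horth : ∀ i j, i ≠ j → p i * p j = 0) (s t : Finset ι) :
    (∑ i ∈ s, p i) * ∑ j ∈ t, p j = ∑ i ∈ s ∩ t, p i := by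
  have h : ∀ i j, p i * p j = if i = j then p i else 0 := by
    intro i j
    split_ifs with hij
    · rw [← hij, hidem]
    · exact horth i j hij
  simp only [Finset.sum_mul_sum, h, Finset.sum_ite_eq, ← Finset.sum_filter,
    Finset.filter_mem_eq_inter]

lemma half_smul_one_add_units {R : Type*} [Ring R] [Algebra ℂ R] (s t : ℤˣ) (x : R) :
    (2 : ℂ)⁻¹ • (x + ((s * t : ℤˣ) : ℤ) • x) = if t = s then x else 0 := by
  have key : (2 : ℂ)⁻¹ • (x + x) = x := by
    rw [← two_smul ℂ x, smul_smul]; norm_num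
  rcases Int.units_eq_one_or s with rfl | rfl <;> rcases Int.units_eq_one_or t with rfl | rfl <;>
    simp [key]

/-- For a magic unitary `u` satisfying the `Qut(G(M,b))` relations, the entries of `u`
are recovered from the elements `y_i`: for every `k` and `α, β ∈ ±1^{S_k}_{b_k}`,
`∏_{i ∈ S_k} (1 + α_i β_i y_i)/2 = u_{(k,α),(k,β)}` (product in increasing order). -/
theorem uRecoveredFromY {m n : ℕ} (M : Matrix (Fin m) (Fin n) (ZMod 2))
    (b : Fin m → ZMod 2)
    {A : Type*} [NormedRing A] [StarRing A] [CStarRing A] [NormedAlgebra ℂ A]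
    [CompleteSpace A]
    (u : GVertex M b → GVertex M b → A)
    (hmu : IsMagicUnitary u) (hqut : QutRel A M b u) :
    ∀ v w : GVertex M b, v.1.1 = w.1.1 →
      (((Sk M v.1.1).sort (· ≤ ·)).map
        (fun i => ((2 : ℂ)⁻¹) • (1 + ((v.1.2 i * w.1.2 i : ℤˣ) : ℤ) • yRep u v i))).prod
      = u v w := by
  classical
  obtain ⟨hstar, hidem, hrow, -⟩ := hmu
  intro v w hvw
  have hproj : ∀ x, IsStarProjection (u v x) := fun x => ⟨hidem v x, hstar v x⟩
  have horth : ∀ x y, x ≠ y → u v x * u v y = 0 := fun x y hxy =>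
    IsStarProjection.mul_eq_zero_of_sum_eq_one hproj (hrow v) hxy.symm
  have hblock : ∑ x with x.1.1 = v.1.1, u v x = 1 := by
    rw [← hrow v]
    refine Finset.sum_subset (Finset.subset_univ _) fun x _ hx => hqut.1 v x fun h => hx ?_
    simp [h]
  have hfactor : ∀ i, (2 : ℂ)⁻¹ • (1 + ((v.1.2 i * w.1.2 i : ℤˣ) : ℤ) • yRep u v i)
      = ∑ x with x.1.1 = v.1.1 ∧ x.1.2 i = w.1.2 i, u v x := by
    intro i
    rw [yRep, Finset.smul_sum, ← hblock, ← Finset.sum_add_distrib, Finset.smul_sum,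
      ← Finset.filter_filter, Finset.sum_filter (fun x : GVertex M b => x.1.2 i = w.1.2 i)]
    refine Finset.sum_congr rfl fun x _ => ?_
    rw [← half_smul_one_add_units (w.1.2 i) (x.1.2 i) (u v x), smul_smul, ← Units.val_mul,
      show v.1.2 i * w.1.2 i * (v.1.2 i * x.1.2 i)
        = (v.1.2 i * v.1.2 i) * (w.1.2 i * x.1.2 i) by
        rw [mul_comm (v.1.2 i) (w.1.2 i)]; ac_rfl, Int.units_mul_self, one_mul]
  have hprod : ∀ l : List (Fin n),
      (l.map fun i => (2 : ℂ)⁻¹ • (1 + ((v.1.2 i * w.1.2 i : ℤˣ) : ℤ) • yRep u v i)).prod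
        = ∑ x with x.1.1 = v.1.1 ∧ ∀ i ∈ l, x.1.2 i = w.1.2 i, u v x := by
    intro l
    induction l with
    | nil => simpa using hblock.symm
    | cons i l ih =>
      rw [List.map_cons, List.prod_cons, ih, hfactor,
        sum_mul_sum_of_orthogonal (hidem v) horth]
      refine Finset.sum_congr ?_ fun _ _ => rfl
      ext x
      simp only [Finset.mem_inter, Finset.mem_filter, Finset.mem_univ, true_and,
        List.forall_mem_cons]
      tauto
  rw [hprod]
  have hset : (univ.filter fun x : GVertex M b =>
      x.1.1 = v.1.1 ∧ ∀ i ∈ (Sk M v.1.1).sort (· ≤ ·), x.1.2 i = w.1.2 i) = {w} := by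
    ext x
    simp only [Finset.mem_filter, Finset.mem_univ, true_and, Finset.mem_singleton,
      Finset.mem_sort]
    constructor
    · rintro ⟨hx, h⟩
      refine Subtype.ext (Prod.ext (hx.trans hvw) (funext fun i => ?_))
      by_cases hi : i ∈ Sk M v.1.1
      · exact h i hi
      · rw [x.2.1 i (hx ▸ hi), w.2.1 i (hvw ▸ hi)]
    · rintro rfl
      exact ⟨hvw.symm, fun _ _ => rfl⟩
  rw [hset, Finset.sum_singleton]
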